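/- Let L be a continuous conditionally-complete distributive lattice and let E be a quasisober topological space. For every L-valued maxitive measure ν on the Borel σ-algebra ℬ of E, there exists a least L-valued maxitive measure ⊥ν on ℬ (the singular part of ν) such that ν⁺(B) = ⌊ν⌋(B) ⊔ ⊥ν(B) for all B ∈ ℬ. Moreover, ⊥ν([x]) = 0 for every x ∈ E, and the singular part of the regular part ⌊ν⌋ is identically 0. -/

import Mathlib

open Set

universe u v

section OrderDefs
variable {L : Type u} [PartialOrder L]

/-- A filtered (nonempty, downward directed) subset of a poset. -/
def DirFiltered (F : Set L) : Prop :=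
  F.Nonempty ∧ ∀ r ∈ F, ∀ s ∈ F, ∃ t ∈ F, t ≤ r ∧ t ≤ s

/-- A filter of a poset: a filtered upper set. -/
def OrdFilter (F : Set L) : Prop :=
  DirFiltered F ∧ ∀ r ∈ F, ∀ s : L, r ≤ s → s ∈ F

/-- Every filter has an infimum. -/
def FilteredComplete (L : Type u) [PartialOrder L] : Prop :=
  ∀ F : Set L, OrdFilter F → ∃ i : L, IsGLB F i

/-- `s` is way-above `r`: for every filter `F` with an infimum below `r`, `s ∈ F`. -/
def WayAbove (s r : L) : Prop :=
  ∀ F : Set L, OrdFilter F → ∀ i : L, IsGLB F i → i ≤ r → s ∈ F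

/-- The poset is continuous: for every `r`, the set of elements way-above `r`
is a filter whose infimum is `r`. -/
def ContinuousPoset (L : Type u) [PartialOrder L] : Prop :=
  ∀ r : L, OrdFilter {s : L | WayAbove s r} ∧ IsGLB {s : L | WayAbove s r} r

/-- Conditional completeness: every nonempty set bounded above has a supremum. -/
def CondComplete (L : Type u) [PartialOrder L] : Prop :=
  ∀ S : Set L, S.Nonempty → BddAbove S → ∃ m : L, IsLUB S m

end OrderDefs

/-- A domain: a filtered-complete continuous poset with a least element. -/
def DomainPoset (L : Type u) [PartialOrder L] [OrderBot L] : Prop :=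
  FilteredComplete L ∧ ContinuousPoset L

section TopDefs
variable {E : Type v} [TopologicalSpace E]

/-- The saturation of a set: intersection of all open sets containing it. -/
def satur (A : Set E) : Set E := ⋂₀ {G : Set E | IsOpen G ∧ A ⊆ G}

/-- A set is saturated if it is an intersection of open sets. -/
def IsSatur (A : Set E) : Prop :=
  ∃ 𝒢 : Set (Set E), (∀ G ∈ 𝒢, IsOpen G) ∧ A = ⋂₀ 𝒢

/-- The collection 𝒬 of compact saturated subsets. -/
def CompactSat (E : Type v) [TopologicalSpace E] : Set (Set E) :=
  {A : Set E | IsCompact A ∧ IsSatur A}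

/-- The Borel σ-algebra generated by open sets and compact saturated sets. -/
def BorelM (E : Type v) [TopologicalSpace E] : MeasurableSpace E :=
  MeasurableSpace.generateFrom ({A : Set E | IsOpen A} ∪ CompactSat E)

/-- Borel subsets for the σ-algebra generated by opens and compact saturated sets. -/
def IsBorelSet (B : Set E) : Prop := @MeasurableSet E (BorelM E) B

/-- The collection 𝒦 of compact Borel subsets. -/
def CompactBorel (E : Type v) [TopologicalSpace E] : Set (Set E) :=
  {A : Set E | IsBorelSet A ∧ IsCompact A}

/-- `[x]` : the compact Borel set `↑{x} ∩ closure {x}`. -/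
def ptClass (x : E) : Set E := satur {x} ∩ closure {x}

end TopDefs

section MeasDefs
variable {L : Type u} {E : Type v} [PartialOrder L] [OrderBot L] [TopologicalSpace E]

/-- An L-valued maxitive measure on the Borel σ-algebra. -/
def Maxitive (ν : Set E → L) : Prop :=
  ν ∅ = ⊥ ∧ ∀ 𝒞 : Set (Set E), 𝒞.Finite → (∀ B ∈ 𝒞, IsBorelSet B) →
    IsLUB (ν '' 𝒞) (ν (⋃₀ 𝒞))

/-- σ-maxitivity. -/
def SigmaMaxitive (ν : Set E → L) : Prop :=
  Maxitive ν ∧ ∀ 𝒞 : Set (Set E), 𝒞.Countable → (∀ B ∈ 𝒞, IsBorelSet B) →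
    IsLUB (ν '' 𝒞) (ν (⋃₀ 𝒞))

/-- Complete maxitivity. -/
def CompletelyMaxitive (ν : Set E → L) : Prop :=
  Maxitive ν ∧ ∀ 𝒞 : Set (Set E), (∀ B ∈ 𝒞, IsBorelSet B) → IsBorelSet (⋃₀ 𝒞) →
    IsLUB (ν '' 𝒞) (ν (⋃₀ 𝒞))

/-- The set `{ν G : G open, G ⊇ B}`. -/
def outerVals (ν : Set E → L) (B : Set E) : Set L :=
  {l : L | ∃ G : Set E, IsOpen G ∧ B ⊆ G ∧ ν G = l}

/-- `νp` is the map `ν⁺ : B ↦ inf {ν G : G open, G ⊇ B}` on Borel sets. -/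
def IsNuPlus (ν νp : Set E → L) : Prop :=
  ∀ B : Set E, IsBorelSet B → IsGLB (outerVals ν B) (νp B)

/-- Outer-continuity. -/
def OuterContinuous (ν : Set E → L) : Prop :=
  ∀ B : Set E, IsBorelSet B → IsGLB (outerVals ν B) (ν B)

/-- Inner-continuity. -/
def InnerContinuous (ν : Set E → L) : Prop :=
  ∀ B : Set E, IsBorelSet B →
    IsLUB {l : L | ∃ K : Set E, IsBorelSet K ∧ IsCompact K ∧ K ⊆ B ∧ ν (satur K) = l} (ν B)

/-- Regularity: inner- and outer-continuity. -/
def RegularMeasure (ν : Set E → L) : Prop :=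
  InnerContinuous ν ∧ OuterContinuous ν

/-- Weak outer-continuity: `ν K = ν⁺ K` for every compact Borel `K`. -/
def WeaklyOuterContinuous (ν : Set E → L) : Prop :=
  ∀ K : Set E, IsBorelSet K → IsCompact K → IsGLB (outerVals ν K) (ν K)

/-- Weak inner-continuity (relative to a given `ν⁺ = νp`). -/
def WeaklyInnerContinuous (ν νp : Set E → L) : Prop :=
  ∀ G : Set E, IsOpen G →
    IsLUB {l : L | ∃ K : Set E, IsBorelSet K ∧ IsCompact K ∧ K ⊆ G ∧ νp K = l} (ν G)

/-- 𝒜-smoothness. -/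
def SmoothWrt (ν : Set E → L) (𝒜 : Set (Set E)) : Prop :=
  ∀ 𝒟 : Set (Set E), 𝒟.Nonempty → 𝒟 ⊆ 𝒜 → DirectedOn (· ⊇ ·) 𝒟 →
    IsGLB (ν '' 𝒟) (ν (⋂₀ 𝒟))

/-- Saturation of a maxitive measure: `ν K = ν (↑K)` for compact Borel `K`. -/
def SaturatedMeasure (ν : Set E → L) : Prop :=
  ∀ K : Set E, IsBorelSet K → IsCompact K → ν K = ν (satur K)

/-- Tightness: `inf {ν (E ∖ K) : K compact Borel} = 0`. -/
def TightMeasure (ν : Set E → L) : Prop :=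
  IsGLB {l : L | ∃ K : Set E, IsBorelSet K ∧ IsCompact K ∧ ν Kᶜ = l} (⊥ : L)

/-- `c` is a cardinal density of `ν`. -/
def IsCardinalDensity (ν : Set E → L) (c : E → L) : Prop :=
  ∀ B : Set E, IsBorelSet B → IsLUB (c '' B) (ν B)

/-- Upper semicontinuity of a map into the poset. -/
def UscMap (c : E → L) : Prop := ∀ t : L, IsOpen {x : E | WayAbove t (c x)}

/-- Upper compactness of a map into the poset. -/
def UpperCompactMap (c : E → L) : Prop :=
  ∀ t : L, WayAbove t (⊥ : L) → IsCompact {x : E | ¬ WayAbove t (c x)}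

/-- Continuity from above along decreasing sequences of Borel sets. -/
def ContinuousFromAbove (ν : Set E → L) : Prop :=
  ∀ B : ℕ → Set E, (∀ n, IsBorelSet (B n)) → (∀ n, B (n + 1) ⊆ B n) →
    IsGLB (Set.range fun n => ν (B n)) (ν (⋂ n, B n))

/-- An optimal measure: a σ-maxitive measure continuous from above. -/
def OptimalMeasure (ν : Set E → L) : Prop :=
  SigmaMaxitive ν ∧ ContinuousFromAbove ν

/-- `flo` is the regular part `⌊ν⌋` (relative to `νp = ν⁺`):
`⌊ν⌋(B) = sup {ν⁺(K) : K compact Borel, K ⊆ B}`. -/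
def RegPartRel (νp flo : Set E → L) : Prop :=
  ∀ B : Set E, IsBorelSet B →
    IsLUB {l : L | ∃ K : Set E, IsBorelSet K ∧ IsCompact K ∧ K ⊆ B ∧ νp K = l} (flo B)

end MeasDefs

section WayAboveLemmas
variable {L : Type u}

theorem WayAbove.mono [PartialOrder L] {t r s : L} (h : WayAbove t r) (hs : s ≤ r) :
    WayAbove t s :=
  fun F hF i hi his => h F hF i hi (his.trans hs)

theorem ContinuousPoset.le_of_forall_wayAbove [PartialOrder L] (h : ContinuousPoset L) {a r : L}
    (H : ∀ t, WayAbove t r → a ≤ t) : a ≤ r :=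
  (h r).2.2 fun t ht => H t ht

theorem ContinuousPoset.le_of_wayAbove [PartialOrder L] (h : ContinuousPoset L) {t r : L}
    (ht : WayAbove t r) : r ≤ t :=
  (h r).2.1 ht

theorem CondComplete.exists_isGLB [PartialOrder L] [OrderBot L] (hcc : CondComplete L) {S : Set L}
    (hS : S.Nonempty) : ∃ i, IsGLB S i := by
  obtain ⟨s, hs⟩ := hS
  obtain ⟨m, hm⟩ := hcc (lowerBounds S) ⟨⊥, fun _ _ => bot_le⟩ ⟨s, fun _ hb => hb hs⟩
  exact ⟨m, isLUB_lowerBounds.1 hm⟩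

/-- In a distributive continuous conditionally complete lattice, `a` has a relative
complement with respect to `f`. -/
theorem exists_isLeast_le_sup [Lattice L] [OrderBot L] (hcc : CondComplete L)
    (hcont : ContinuousPoset L) (hdist : ∀ a b c : L, a ⊓ (b ⊔ c) = a ⊓ b ⊔ a ⊓ c) (a f : L) :
    ∃ i, IsLeast {b | a ≤ f ⊔ b} i := by
  have hne : {b | a ≤ f ⊔ b}.Nonempty := ⟨a, le_sup_right⟩
  obtain ⟨i, hi⟩ := hcc.exists_isGLB hne
  refine ⟨i, hcont.le_of_forall_wayAbove fun t ht => ?_, hi.1⟩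
  have hfilter : OrdFilter {b | a ≤ f ⊔ b} := by
    refine ⟨⟨hne, fun r hr s hs => ⟨r ⊓ s, ?_, inf_le_left, inf_le_right⟩⟩,
      fun r hr s hrs => le_trans hr (sup_le_sup_left hrs f)⟩
    refine (le_inf hr hs).trans ?_
    rw [hdist (f ⊔ r) f s, inf_comm (f ⊔ r) s, hdist s f r, inf_comm s r]
    exact sup_le (inf_le_right.trans le_sup_left) (sup_le_sup_right inf_le_right _)
  have hmem : a ≤ f ⊔ t := ht.mono le_sup_right _ hfilter i hi le_rfl
  exact hmem.trans (sup_le (le_sup_left.trans (hcont.le_of_wayAbove ht)) le_rfl)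

end WayAboveLemmas

section BorelLemmas
variable {E : Type v} [TopologicalSpace E]

theorem IsOpen.isBorelSet {G : Set E} (h : IsOpen G) : IsBorelSet G :=
  MeasurableSpace.measurableSet_generateFrom (Or.inl h)

theorem IsBorelSet.union {A B : Set E} (hA : IsBorelSet A) (hB : IsBorelSet B) :
    IsBorelSet (A ∪ B) :=
  @MeasurableSet.union E (BorelM E) A B hA hB

theorem IsBorelSet.inter {A B : Set E} (hA : IsBorelSet A) (hB : IsBorelSet B) :
    IsBorelSet (A ∩ B) :=
  @MeasurableSet.inter E (BorelM E) A B hA hB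

theorem isBorelSet_empty : IsBorelSet (∅ : Set E) :=
  @MeasurableSet.empty E (BorelM E)

theorem IsOpen.ptClass_subset {G : Set E} (hG : IsOpen G) {x : E} (hx : x ∈ G) :
    ptClass x ⊆ G :=
  fun _ hy => hy.1 G ⟨hG, singleton_subset_iff.2 hx⟩

theorem mem_ptClass_self (x : E) : x ∈ ptClass x :=
  ⟨fun _ hG => hG.2 rfl, subset_closure rfl⟩

theorem mem_satur_singleton {x y : E} : y ∈ satur {x} ↔ y ⤳ x := by
  simp only [satur, mem_sInter, mem_ofPred_eq, singleton_subset_iff, and_imp,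
    specializes_iff_forall_open]

theorem mem_ptClass_iff {x y : E} : y ∈ ptClass x ↔ Inseparable x y := by
  rw [inseparable_iff_specializes_and, specializes_iff_mem_closure, ptClass, mem_inter_iff,
    mem_satur_singleton, and_comm]

theorem isCompact_satur_singleton (x : E) : IsCompact (satur {x} : Set E) := by
  refine isCompact_of_finite_subcover fun {ι} U hU hcov => ?_
  obtain ⟨i, hi⟩ := mem_iUnion.1 (hcov fun G hG => hG.2 rfl : x ∈ _)
  exact ⟨{i}, fun y hy => by simpa using hy (U i) ⟨hU i, singleton_subset_iff.2 hi⟩⟩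

theorem isCompact_ptClass (x : E) : IsCompact (ptClass x) :=
  (isCompact_satur_singleton x).inter_right isClosed_closure

theorem isBorelSet_ptClass (x : E) : IsBorelSet (ptClass x) := by
  refine IsBorelSet.inter ?_ ?_
  · exact MeasurableSpace.measurableSet_generateFrom
      (Or.inr ⟨isCompact_satur_singleton x, _, fun G hG => hG.1, rfl⟩)
  · exact (@MeasurableSet.compl_iff E _ (BorelM E)).1
      (isClosed_closure.isOpen_compl.isBorelSet)

theorem Inseparable.mem_borelSet_iff {x y : E} (h : Inseparable x y) {B : Set E}
    (hB : IsBorelSet B) : x ∈ B ↔ y ∈ B := by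
  refine MeasurableSpace.generateFrom_induction _ (fun s _ => (x ∈ s ↔ y ∈ s)) ?_ Iff.rfl
    (fun s _ hs => not_congr hs) (fun s _ hs => by simp [hs]) B hB
  rintro s (hs | ⟨-, 𝒢, h𝒢, rfl⟩) -
  · exact h.mem_open_iff hs
  · exact forall₂_congr fun G hG => h.mem_open_iff (h𝒢 G hG)

theorem IsBorelSet.ptClass_subset {B : Set E} (hB : IsBorelSet B) {x : E} (hx : x ∈ B) :
    ptClass x ⊆ B :=
  fun _ hy => ((mem_ptClass_iff.1 hy).mem_borelSet_iff hB).1 hx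

end BorelLemmas

section MaxitiveLemmas
variable {L : Type u} {E : Type v} [Lattice L] [OrderBot L] [TopologicalSpace E]
  {ν νp flo : Set E → L} {A B : Set E}

theorem Maxitive.union (hν : Maxitive ν) (hA : IsBorelSet A) (hB : IsBorelSet B) :
    ν (A ∪ B) = ν A ⊔ ν B := by
  have h := hν.2 {A, B} (by simp) (by simp [hA, hB])
  rw [image_pair, sUnion_pair] at h
  exact h.unique isLUB_pair

theorem Maxitive.mono (hν : Maxitive ν) (hA : IsBorelSet A) (hB : IsBorelSet B) (h : A ⊆ B) :
    ν A ≤ ν B := by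
  rw [← union_eq_self_of_subset_left h, hν.union hA hB]
  exact le_sup_left

theorem Maxitive.of_union (h0 : ν ∅ = ⊥)
    (h : ∀ A B, IsBorelSet A → IsBorelSet B → ν (A ∪ B) = ν A ⊔ ν B) : Maxitive ν := by
  refine ⟨h0, fun 𝒞 hfin h𝒞 => ?_⟩
  suffices IsBorelSet (⋃₀ 𝒞) ∧ IsLUB (ν '' 𝒞) (ν (⋃₀ 𝒞)) from this.2
  induction 𝒞, hfin using Set.Finite.induction_on with
  | empty => simp [h0, isBorelSet_empty]
  | @insert A 𝒞 _ _ ih =>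
    obtain ⟨hb, hl⟩ := ih fun B hB => h𝒞 B (mem_insert_of_mem _ hB)
    have hA := h𝒞 A (mem_insert _ _)
    rw [sUnion_insert, image_insert_eq, h _ _ hA hb]
    exact ⟨hA.union hb, hl.insert _⟩

theorem Maxitive.bot : Maxitive (fun _ : Set E => (⊥ : L)) :=
  .of_union rfl fun _ _ _ _ => (sup_idem _).symm

theorem IsNuPlus.le (hνp : IsNuPlus ν νp) {G : Set E} (hB : IsBorelSet B) (hG : IsOpen G)
    (h : B ⊆ G) : νp B ≤ ν G :=
  (hνp B hB).1 ⟨G, hG, h, rfl⟩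

theorem IsNuPlus.mono (hνp : IsNuPlus ν νp) (hA : IsBorelSet A) (hB : IsBorelSet B)
    (h : A ⊆ B) : νp A ≤ νp B := by
  refine (hνp B hB).2 ?_
  rintro _ ⟨G, hG, hBG, rfl⟩
  exact hνp.le hA hG (h.trans hBG)

theorem IsNuPlus.map_empty (hνp : IsNuPlus ν νp) (hν : Maxitive ν) : νp ∅ = ⊥ :=
  le_bot_iff.1 ((hνp.le isBorelSet_empty isOpen_empty subset_rfl).trans hν.1.le)

theorem IsNuPlus.exists_isOpen_le (hνp : IsNuPlus ν νp) (hν : Maxitive ν) (hB : IsBorelSet B)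
    {t : L} (ht : WayAbove t (νp B)) : ∃ G, IsOpen G ∧ B ⊆ G ∧ ν G ≤ t := by
  refine ht {l | ∃ G, IsOpen G ∧ B ⊆ G ∧ ν G ≤ l} ⟨⟨?_, ?_⟩, ?_⟩ (νp B) ⟨?_, ?_⟩ le_rfl
  · exact ⟨ν univ, univ, isOpen_univ, subset_univ _, le_rfl⟩
  · rintro r ⟨G, hG, hBG, hGr⟩ s ⟨H, hH, hBH, hHs⟩
    have hGH := hG.inter hH
    exact ⟨ν (G ∩ H), ⟨_, hGH, subset_inter hBG hBH, le_rfl⟩,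
      (hν.mono hGH.isBorelSet hG.isBorelSet inter_subset_left).trans hGr,
      (hν.mono hGH.isBorelSet hH.isBorelSet inter_subset_right).trans hHs⟩
  · rintro r ⟨G, hG, hBG, hGr⟩ s hrs
    exact ⟨G, hG, hBG, hGr.trans hrs⟩
  · rintro r ⟨G, hG, hBG, hGr⟩
    exact (hνp.le hB hG hBG).trans hGr
  · exact fun b hb => (hνp B hB).2 fun _ ⟨G, hG, hBG, h⟩ => hb ⟨G, hG, hBG, h.le⟩

theorem IsNuPlus.union_le (hνp : IsNuPlus ν νp) (hν : Maxitive ν) (hcont : ContinuousPoset L)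
    (hA : IsBorelSet A) (hB : IsBorelSet B) : νp (A ∪ B) ≤ νp A ⊔ νp B := by
  refine hcont.le_of_forall_wayAbove fun t ht => ?_
  obtain ⟨G, hG, hAG, hGt⟩ := hνp.exists_isOpen_le hν hA (ht.mono le_sup_left)
  obtain ⟨H, hH, hBH, hHt⟩ := hνp.exists_isOpen_le hν hB (ht.mono le_sup_right)
  refine (hνp.le (hA.union hB) (hG.union hH) (union_subset_union hAG hBH)).trans ?_
  rw [hν.union hG.isBorelSet hH.isBorelSet]
  exact sup_le hGt hHt

theorem RegPartRel.mono (hflo : RegPartRel νp flo) (hA : IsBorelSet A) (hB : IsBorelSet B)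
    (h : A ⊆ B) : flo A ≤ flo B :=
  (hflo A hA).2 fun _ ⟨K, hK, hKc, hKA, e⟩ => (hflo B hB).1 ⟨K, hK, hKc, hKA.trans h, e⟩

theorem RegPartRel.le (hflo : RegPartRel νp flo) (hνp : IsNuPlus ν νp) (hB : IsBorelSet B) :
    flo B ≤ νp B := by
  refine (hflo B hB).2 ?_
  rintro _ ⟨K, hK, -, hKB, rfl⟩
  exact hνp.mono hK hB hKB

theorem RegPartRel.le_of_isCompact (hflo : RegPartRel νp flo) {K : Set E} (hK : IsBorelSet K)
    (hKc : IsCompact K) : νp K ≤ flo K :=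
  (hflo K hK).1 ⟨K, hK, hKc, subset_rfl, rfl⟩

theorem IsNuPlus.le_of_isCompact_of_forall_mem (hνp : IsNuPlus ν νp) (hν : Maxitive ν) {K : Set E}
    (hK : IsBorelSet K) (hKc : IsCompact K) {t : L}
    (h : ∀ x ∈ K, ∃ G, IsOpen G ∧ x ∈ G ∧ ν G ≤ t) : νp K ≤ t := by
  obtain ⟨G, hG, hKG, hGt⟩ : ∃ G, IsOpen G ∧ K ⊆ G ∧ ν G ≤ t := by
    refine hKc.induction_on (p := fun s => ∃ G, IsOpen G ∧ s ⊆ G ∧ ν G ≤ t)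
      ⟨∅, isOpen_empty, subset_rfl, by simp [hν.1]⟩
      (fun s s' hs ⟨G, hG, hsG, hGt⟩ => ⟨G, hG, hs.trans hsG, hGt⟩) ?_ fun x hx => ?_
    · rintro s s' ⟨G, hG, hsG, hGt⟩ ⟨H, hH, hsH, hHt⟩
      refine ⟨G ∪ H, hG.union hH, union_subset_union hsG hsH, ?_⟩
      rw [hν.union hG.isBorelSet hH.isBorelSet]
      exact sup_le hGt hHt
    · obtain ⟨G, hG, hxG, hGt⟩ := h x hx
      exact ⟨G, mem_nhdsWithin_of_mem_nhds (hG.mem_nhds hxG), G, hG, subset_rfl, hGt⟩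
  exact (hνp.le hK hG hKG).trans hGt

/-- The regular part of a maxitive measure is outer-continuous. -/
theorem RegPartRel.outerContinuous (hflo : RegPartRel νp flo) (hνp : IsNuPlus ν νp)
    (hν : Maxitive ν) (hcont : ContinuousPoset L) : OuterContinuous flo := by
  refine fun B hB => ⟨?_, fun b hb => hcont.le_of_forall_wayAbove fun t ht => ?_⟩
  · rintro _ ⟨G, hG, hBG, rfl⟩
    exact hflo.mono hB hG.isBorelSet hBG
  have hloc : ∀ x ∈ B, ∃ G, IsOpen G ∧ x ∈ G ∧ ν G ≤ t := fun x hx => by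
    have hle := (hflo.le_of_isCompact (isBorelSet_ptClass x) (isCompact_ptClass x)).trans
      (hflo.mono (isBorelSet_ptClass x) hB (hB.ptClass_subset hx))
    obtain ⟨G, hG, hxG, hGt⟩ := hνp.exists_isOpen_le hν (isBorelSet_ptClass x) (ht.mono hle)
    exact ⟨G, hG, hxG (mem_ptClass_self x), hGt⟩
  have hU : IsOpen (⋃₀ {G | IsOpen G ∧ ν G ≤ t}) := isOpen_sUnion fun G hG => hG.1
  refine (hb ⟨_, hU, fun x hx => ?_, rfl⟩).trans ((hflo _ hU.isBorelSet).2 ?_)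
  · obtain ⟨G, hG, hxG, hGt⟩ := hloc x hx
    exact ⟨G, ⟨hG, hGt⟩, hxG⟩
  · rintro _ ⟨K, hK, hKc, hKU, rfl⟩
    refine hνp.le_of_isCompact_of_forall_mem hν hK hKc fun x hx => ?_
    obtain ⟨G, ⟨hG, hGt⟩, hxG⟩ := hKU hx
    exact ⟨G, hG, hxG, hGt⟩

/-- The regular part operation is idempotent on maxitive measures. -/
theorem RegPartRel.regPart_eq {flop floflo : Set E → L} (hflo : RegPartRel νp flo)
    (hνp : IsNuPlus ν νp) (hν : Maxitive ν) (hcont : ContinuousPoset L)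
    (hflop : IsNuPlus flo flop) (hfloflo : RegPartRel flop floflo) (hB : IsBorelSet B) :
    flop B = floflo B := by
  have heq : ∀ {C : Set E}, IsBorelSet C → flop C = flo C := fun {C} hC =>
    (hflop C hC).unique (hflo.outerContinuous hνp hν hcont C hC)
  refine le_antisymm ?_ (hfloflo.le hflop hB)
  rw [heq hB]
  refine (hflo B hB).2 ?_
  rintro _ ⟨K, hK, hKc, hKB, rfl⟩
  refine (hflo.le_of_isCompact hK hKc).trans ?_
  rw [← heq hK]
  exact (hfloflo B hB).1 ⟨K, hK, hKc, hKB, rfl⟩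

end MaxitiveLemmas

/-- existence of the singular part `⊥ν`, least maxitive measure with
`ν⁺ = ⌊ν⌋ ⊔ ⊥ν`; moreover `⊥ν([x]) = 0` and the singular part of `⌊ν⌋` is 0. -/
theorem stmt3 {L : Type u} {E : Type v} [Lattice L] [OrderBot L]
    [TopologicalSpace E] [QuasiSober E]
    (hcc : CondComplete L) (hcont : ContinuousPoset L)
    (hdist : ∀ a b c : L, a ⊓ (b ⊔ c) = a ⊓ b ⊔ a ⊓ c)
    (ν νp flo : Set E → L) (hν : Maxitive ν) (hνp : IsNuPlus ν νp)
    (hflo : RegPartRel νp flo) :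
    ∃ bn : Set E → L, Maxitive bn ∧
      (∀ B : Set E, IsBorelSet B → νp B = flo B ⊔ bn B) ∧
      (∀ τ : Set E → L, Maxitive τ → (∀ B : Set E, IsBorelSet B → νp B = flo B ⊔ τ B) →
        ∀ B : Set E, IsBorelSet B → bn B ≤ τ B) ∧
      (∀ x : E, bn (ptClass x) = ⊥) ∧
      (∀ flop floflo τ : Set E → L, IsNuPlus flo flop → RegPartRel flop floflo →
        Maxitive τ → (∀ B : Set E, IsBorelSet B → flop B = floflo B ⊔ τ B) →
        (∀ σ : Set E → L, Maxitive σ → (∀ B : Set E, IsBorelSet B → flop B = floflo B ⊔ σ B) →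
          ∀ B : Set E, IsBorelSet B → τ B ≤ σ B) →
        ∀ B : Set E, IsBorelSet B → τ B = ⊥) := by
  choose d hd using fun B : Set E => exists_isLeast_le_sup hcc hcont hdist (νp B) (flo B)
  have hdle : ∀ {B : Set E} {b : L}, νp B ≤ flo B ⊔ b → d B ≤ b := fun h => (hd _).2 h
  have hbdd : ∀ B, IsBorelSet B → ∀ A, IsBorelSet A → A ⊆ B → d A ≤ νp B :=
    fun B hB A hA hAB => (hdle le_sup_right).trans (hνp.mono hA hB hAB)
  have hex : ∀ B, ∃ m, IsBorelSet B → IsLUB {l | ∃ A, IsBorelSet A ∧ A ⊆ B ∧ d A = l} m := by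
    intro B
    by_cases hB : IsBorelSet B
    · obtain ⟨m, hm⟩ := hcc {l | ∃ A, IsBorelSet A ∧ A ⊆ B ∧ d A = l} ⟨_, B, hB, subset_rfl, rfl⟩
        ⟨νp B, by rintro _ ⟨A, hA, hAB, rfl⟩; exact hbdd B hB A hA hAB⟩
      exact ⟨m, fun _ => hm⟩
    · exact ⟨⊥, fun h => absurd h hB⟩
  choose bn hbn using hex
  have hle : ∀ {A B}, IsBorelSet A → IsBorelSet B → A ⊆ B → d A ≤ bn B :=
    fun {A B} hA hB h => (hbn B hB).1 ⟨A, hA, h, rfl⟩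
  have hbn_le : ∀ {B} {b : L}, IsBorelSet B → (∀ A, IsBorelSet A → A ⊆ B → d A ≤ b) →
      bn B ≤ b := fun {B b} hB h => (hbn B hB).2 (by rintro _ ⟨A, hA, hAB, rfl⟩; exact h A hA hAB)
  have hd0 : d ∅ = ⊥ := le_bot_iff.1 (hdle (by rw [hνp.map_empty hν]; exact bot_le))
  refine ⟨bn, .of_union (le_bot_iff.1 (hbn_le isBorelSet_empty ?_)) ?_, ?_, ?_, ?_, ?_⟩
  · rintro A - hA
    rw [subset_empty_iff.1 hA, hd0]
  · intro A B hA hB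
    refine le_antisymm (hbn_le (hA.union hB) fun C hC hCAB => ?_)
      (sup_le (hbn_le hA fun C hC h => hle hC (hA.union hB) (h.trans subset_union_left))
        (hbn_le hB fun C hC h => hle hC (hA.union hB) (h.trans subset_union_right)))
    have hCA := hC.inter hA
    have hCB := hC.inter hB
    refine (hdle ?_).trans (sup_le_sup (hle hCA hA inter_subset_right)
      (hle hCB hB inter_subset_right))
    have hun := hνp.union_le hν hcont hCA hCB
    rw [← inter_union_distrib_left, inter_eq_left.2 hCAB] at hun
    refine hun.trans (sup_le ((hd (C ∩ A)).1.trans ?_) ((hd (C ∩ B)).1.trans ?_))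
    · exact sup_le_sup (hflo.mono hCA hC inter_subset_left) le_sup_left
    · exact sup_le_sup (hflo.mono hCB hC inter_subset_left) le_sup_right
  · intro B hB
    exact le_antisymm ((hd B).1.trans (sup_le_sup_left (hle hB hB subset_rfl) _))
      (sup_le (hflo.le hνp hB) (hbn_le hB (hbdd B hB)))
  · intro τ hτ hτeq B hB
    exact hbn_le hB fun A hA hAB => (hdle (hτeq A hA).le).trans (hτ.mono hA hB hAB)
  · intro x
    refine le_bot_iff.1 (hbn_le (isBorelSet_ptClass x) fun A hA hAx => ?_)
    obtain rfl | ⟨y, hy⟩ := A.eq_empty_or_nonempty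
    · exact hd0.le
    · have hx : x ∈ A := ((mem_ptClass_iff.1 (hAx hy)).mem_borelSet_iff hA).2 hy
      rw [hAx.antisymm (hA.ptClass_subset hx)]
      exact hdle ((hflo.le_of_isCompact (isBorelSet_ptClass x)
        (isCompact_ptClass x)).trans le_sup_left)
  · intro flop floflo τ hflop hfloflo hτ hτeq hmin B hB
    refine le_bot_iff.1 (hmin (fun _ => ⊥) .bot (fun C hC => ?_) B hB)
    rw [sup_bot_eq]
    exact hflo.regPart_eq hνp hν hcont hflop hfloflo hC
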